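/- Let A be a tree-like OCATA, θ an infinite timed word, π an Id-run of A on θ, and π' an Id-run of the dual automaton A^C on θ. Then π and π' have a common branch: there exists a sequence e₀e₁e₂⋯ of states such that for every i, e_i belongs both to the i-th configuration of π and to the i-th configuration of π', and consecutive elements are linked by an edge in the DAG of π and by an edge in the DAG of π'. -/

import Mathlib

namespace OcataPaper

open Set

/-! ### Clock constraints and transition formulas `Γ(L)` -/

inductive Cmp : Type
  | lt | le | gt | ge
deriving DecidableEq

def Cmp.eval : Cmp → ℝ → ℕ → Prop
  | .lt, v, c => v < c
  | .le, v, c => v ≤ c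
  | .gt, v, c => v > c
  | .ge, v, c => v ≥ c

def Cmp.negate : Cmp → Cmp
  | .lt => .ge
  | .le => .gt
  | .gt => .le
  | .ge => .lt

inductive TransFormula (L : Type*) : Type _
  | tt : TransFormula L
  | ff : TransFormula L
  | or (γ₁ γ₂ : TransFormula L) : TransFormula L
  | and (γ₁ γ₂ : TransFormula L) : TransFormula L
  | loc (ℓ : L) : TransFormula L
  | cmp (op : Cmp) (c : ℕ) : TransFormula L
  | reset (γ : TransFormula L) : TransFormula L

/-- The locations occurring in a formula of `Γ(L)`. -/
def TransFormula.locs {L : Type*} : TransFormula L → Set L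
  | .tt => ∅
  | .ff => ∅
  | .or γ₁ γ₂ => γ₁.locs ∪ γ₂.locs
  | .and γ₁ γ₂ => γ₁.locs ∪ γ₂.locs
  | .loc ℓ => {ℓ}
  | .cmp _ _ => ∅
  | .reset γ => γ.locs

/-- The constants occurring in clock constraints of a formula of `Γ(L)`. -/
def TransFormula.consts {L : Type*} : TransFormula L → Set ℕ
  | .tt => ∅
  | .ff => ∅
  | .or γ₁ γ₂ => γ₁.consts ∪ γ₂.consts
  | .and γ₁ γ₂ => γ₁.consts ∪ γ₂.consts
  | .loc _ => ∅
  | .cmp _ c => {c}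
  | .reset γ => γ.consts

def TransFormula.map {L L' : Type*} (g : L → L') : TransFormula L → TransFormula L'
  | .tt => .tt
  | .ff => .ff
  | .or γ₁ γ₂ => .or (γ₁.map g) (γ₂.map g)
  | .and γ₁ γ₂ => .and (γ₁.map g) (γ₂.map g)
  | .loc ℓ => .loc (g ℓ)
  | .cmp op c => .cmp op c
  | .reset γ => .reset (γ.map g)

/-- The dual `γ̄` of a formula of `Γ(L)`. -/
def TransFormula.dual {L : Type*} : TransFormula L → TransFormula L
  | .tt => .ff
  | .ff => .tt
  | .or γ₁ γ₂ => .and γ₁.dual γ₂.dual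
  | .and γ₁ γ₂ => .or γ₁.dual γ₂.dual
  | .loc ℓ => .loc ℓ
  | .cmp op c => .cmp op.negate c
  | .reset γ => .reset γ.dual

/-! ### One-clock alternating timed automata -/

structure OCATA (A : Type*) (L : Type*) where
  init : L
  final : Set L
  δ : L → A → TransFormula L

/-- The dual automaton `A^C`. -/
def OCATA.dual {A L : Type*} (Aut : OCATA A L) : OCATA A L where
  init := Aut.init
  final := Aut.finalᶜ
  δ := fun ℓ σ => (Aut.δ ℓ σ).dual

/-! ### The interval semantics -/

/-- A state of an OCATA in the interval semantics: a location and a clock interval. -/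
abbrev OState (L : Type*) := L × Set ℝ

/-- The interval `[0,0]`. -/
def zeroItv : Set ℝ := {0}

/-- `I` is an interval with endpoints in `ℝ⁺`. -/
def IsItv (I : Set ℝ) : Prop :=
  I.Nonempty ∧ I.OrdConnected ∧ BddAbove I ∧ ∀ x ∈ I, 0 ≤ x

/-- `C(ℓ)`: the intervals associated with location `ℓ` in `C`. -/
def locSet {L : Type*} (C : Set (OState L)) (ℓ : L) : Set (Set ℝ) := {I | (ℓ, I) ∈ C}

/-- Configurations: finite sets of states, intervals of a same location pairwise disjoint. -/
def IsConfig {L : Type*} (C : Set (OState L)) : Prop :=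
  C.Finite ∧ (∀ s ∈ C, IsItv s.2) ∧
    ∀ ℓ I J, (ℓ, I) ∈ C → (ℓ, J) ∈ C → I ≠ J → Disjoint I J

/-- `I + t`. -/
def shiftItv (I : Set ℝ) (t : ℝ) : Set ℝ := (fun x => x + t) '' I

/-- `C + t`. -/
def shiftCfg {L : Type*} (C : Set (OState L)) (t : ℝ) : Set (OState L) :=
  (fun s => (s.1, shiftItv s.2 t)) '' C

/-- The satisfaction relation `M ⊨_I γ`. -/
def Models {L : Type*} (M : Set (OState L)) : TransFormula L → Set ℝ → Prop
  | .tt, _ => True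
  | .ff, _ => False
  | .or γ₁ γ₂, I => Models M γ₁ I ∨ Models M γ₂ I
  | .and γ₁ γ₂, I => Models M γ₁ I ∧ Models M γ₂ I
  | .loc ℓ, I => (ℓ, I) ∈ M
  | .cmp op c, I => ∀ v ∈ I, op.eval v c
  | .reset γ, _ => Models M γ zeroItv

/-- `M` is a minimal model of `γ` w.r.t. `I`. -/
def IsMinModel {L : Type*} (M : Set (OState L)) (γ : TransFormula L) (I : Set ℝ) : Prop :=
  Models M γ I ∧ ∀ M' ⊂ M, ¬ Models M' γ I

/-- `‖E‖`: one clock per singular interval, two per non-singular interval. -/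
noncomputable def nbClocks (E : Set (Set ℝ)) : ℕ :=
  ({I ∈ E | ∃ a : ℝ, I = {a}}).ncard + 2 * ({I ∈ E | ¬ ∃ a : ℝ, I = {a}}).ncard

/-- `‖C‖ = Σ_ℓ ‖C(ℓ)‖`. -/
noncomputable def nbClocksC {L : Type*} (C : Set (OState L)) : ℕ :=
  ({s ∈ C | ∃ a : ℝ, s.2 = {a}}).ncard + 2 * ({s ∈ C | ¬ ∃ a : ℝ, s.2 = {a}}).ncard

/-- Approximation functions. -/
def IsApproxFun {L : Type*} (f : Set (OState L) → Set (Set (OState L))) : Prop :=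
  ∀ C, IsConfig C → ∀ C' ∈ f C, IsConfig C' ∧ ∀ ℓ : L,
    nbClocks (locSet C' ℓ) ≤ nbClocks (locSet C ℓ) ∧
    (∀ I ∈ locSet C ℓ, ∃ J ∈ locSet C' ℓ, I ⊆ J) ∧
    (∀ J ∈ locSet C' ℓ,
      (∃ I₁ ∈ locSet C ℓ, sInf J = sInf I₁) ∧ (∃ I₂ ∈ locSet C ℓ, sSup J = sSup I₂))

/-! ### Infinite timed words -/

/-- An infinite timed word: letters `σ₁σ₂⋯` and a non-decreasing time sequence `τ₁τ₂⋯`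
(positions are `≥ 1`; by convention `τ₀ = 0`). -/
structure TimedWord (A : Type*) where
  letter : ℕ → A
  time : ℕ → ℝ
  time_zero : time 0 = 0
  mono : Monotone time

/-! ### `f`-runs (as DAGs, with the chosen minimal models recorded) -/

structure FRun {A L : Type*} (Aut : OCATA A L)
    (f : Set (OState L) → Set (Set (OState L))) (θ : TimedWord A) where
  config : ℕ → Set (OState L)
  model : ℕ → OState L → Set (OState L)
  init : config 0 = {(Aut.init, zeroItv)}
  isConfig : ∀ i, IsConfig (config i)
  minModel : ∀ i, ∀ s ∈ shiftCfg (config i) (θ.time (i + 1) - θ.time i),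
    IsMinModel (model i s) (Aut.δ s.1 (θ.letter (i + 1))) s.2
  succ : ∀ i, config (i + 1) ∈
    f (⋃ s ∈ shiftCfg (config i) (θ.time (i + 1) - θ.time i), model i s)

/-- The edges of the DAG of a run (via `dest`). -/
def FRun.Edge {A L : Type*} {Aut : OCATA A L}
    {f : Set (OState L) → Set (Set (OState L))} {θ : TimedWord A}
    (ρ : FRun Aut f θ) (i : ℕ) (s s' : OState L) : Prop :=
  s ∈ ρ.config i ∧ s' ∈ ρ.config (i + 1) ∧
  ∃ I, (s'.1, I) ∈ ρ.model i (s.1, shiftItv s.2 (θ.time (i + 1) - θ.time i)) ∧ I ⊆ s'.2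

/-- An (infinite) branch of the DAG of a run. -/
def FRun.IsBranch {A L : Type*} {Aut : OCATA A L}
    {f : Set (OState L) → Set (Set (OState L))} {θ : TimedWord A}
    (ρ : FRun Aut f θ) (β : ℕ → OState L) : Prop :=
  β 0 = (Aut.init, zeroItv) ∧ ∀ i, ρ.Edge i (β i) (β (i + 1))

/-- Büchi acceptance: every infinite branch visits accepting locations infinitely often. -/
def FRun.Accepting {A L : Type*} {Aut : OCATA A L}
    {f : Set (OState L) → Set (Set (OState L))} {θ : TimedWord A}
    (ρ : FRun Aut f θ) : Prop :=
  ∀ β, ρ.IsBranch β → ∀ N, ∃ i, N ≤ i ∧ (β i).1 ∈ Aut.final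

/-- The identity approximation function, giving the standard semantics. -/
def IdApprox {L : Type*} : Set (OState L) → Set (Set (OState L)) := fun C => {C}

/-- `L^ω_f(A)`. -/
def FLang {A L : Type*} (Aut : OCATA A L)
    (f : Set (OState L) → Set (Set (OState L))) : Set (TimedWord A) :=
  {θ | ∃ ρ : FRun Aut f θ, ρ.Accepting}

/-! ### Tree-like OCATA -/

/-- `B ≼ B'` : some location of `B` occurs in `δ(ℓ,σ)` for some `ℓ ∈ B'`. -/
def BlockRel {A L : Type*} (Aut : OCATA A L) (B B' : Set L) : Prop :=
  ∃ σ : A, ∃ ℓ ∈ B', ∃ ℓ' ∈ B, ℓ' ∈ (Aut.δ ℓ σ).locs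

/-- Tree-like OCATA: partition of the locations into blocks, each fully accepting or fully
non-accepting, with the occurrence relation between blocks a partial order
(antisymmetric, and transitive up to reflexivity). -/
def IsTOCATA {A L : Type*} (Aut : OCATA A L) : Prop :=
  ∃ P : Set (Set L), Setoid.IsPartition P ∧
    (∀ B ∈ P, B ⊆ Aut.final ∨ B ∩ Aut.final = ∅) ∧
    (∀ B ∈ P, ∀ B' ∈ P, BlockRel Aut B B' → BlockRel Aut B' B → B = B') ∧
    (∀ B ∈ P, ∀ B' ∈ P, ∀ B'' ∈ P,
      BlockRel Aut B B' → BlockRel Aut B' B'' → B = B'' ∨ BlockRel Aut B B'')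


/-! ### MTL / MITL formulas (in negative normal form when `IsNNF` holds) -/

/-- An interval with endpoints in `ℕ ∪ {+∞}` (`hi = none` means `+∞`). -/
structure TimeItv where
  lo : ℕ
  hi : Option ℕ
  loIncl : Bool
  hiIncl : Bool
deriving DecidableEq

def TimeItv.Mem (I : TimeItv) (t : ℝ) : Prop :=
  (if I.loIncl then (I.lo : ℝ) ≤ t else (I.lo : ℝ) < t) ∧
  (match I.hi with
   | none => True
   | some h => if I.hiIncl then t ≤ (h : ℝ) else t < (h : ℝ))

def TimeItv.Nonsingular (I : TimeItv) : Prop :=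
  match I.hi with
  | none => True
  | some h => I.lo < h

/-- The guard `x ∈ I` as a formula of `Γ(L)`. -/
def TimeItv.memF {L : Type*} (I : TimeItv) : TransFormula L :=
  .and (if I.loIncl then .cmp .ge I.lo else .cmp .gt I.lo)
    (match I.hi with
     | none => .tt
     | some h => if I.hiIncl then .cmp .le h else .cmp .lt h)

/-- The guard `x ∉ I`. -/
def TimeItv.notMemF {L : Type*} (I : TimeItv) : TransFormula L :=
  .or (if I.loIncl then .cmp .lt I.lo else .cmp .le I.lo)
    (match I.hi with
     | none => .ff
     | some h => if I.hiIncl then .cmp .gt h else .cmp .ge h)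

/-- The guard `x ≤ sup(I)`. -/
def TimeItv.leSupF {L : Type*} (I : TimeItv) : TransFormula L :=
  match I.hi with
  | none => .tt
  | some h => .cmp .le h

/-- The guard `x > sup(I)`. -/
def TimeItv.gtSupF {L : Type*} (I : TimeItv) : TransFormula L :=
  match I.hi with
  | none => .ff
  | some h => .cmp .gt h

/-- `⌈inf(I)/|I|⌉` (0 when `I` is unbounded). -/
def TimeItv.ceilInfDiv (I : TimeItv) : ℕ :=
  match I.hi with
  | none => 0
  | some h => ⌈(I.lo : ℚ) / ((h : ℚ) - (I.lo : ℚ))⌉₊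

/-- `⌈sup(I)/|I|⌉` (0 when `I` is unbounded). -/
def TimeItv.ceilSupDiv (I : TimeItv) : ℕ :=
  match I.hi with
  | none => 0
  | some h => ⌈(h : ℚ) / ((h : ℚ) - (I.lo : ℚ))⌉₊

/-- MTL formulas; `untl` is `U_I` and `rele` is `Ũ_I`. -/
inductive MTL (A : Type*) : Type _
  | tt : MTL A
  | ff : MTL A
  | atom (a : A) : MTL A
  | neg (φ : MTL A) : MTL A
  | and (φ₁ φ₂ : MTL A) : MTL A
  | or (φ₁ φ₂ : MTL A) : MTL A
  | untl (φ₁ φ₂ : MTL A) (I : TimeItv) : MTL A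
  | rele (φ₁ φ₂ : MTL A) (I : TimeItv) : MTL A

/-- The pointwise semantics `(θ, i) ⊨ φ` (`Ũ` by definition dual to `U`). -/
def MTL.Sat {A : Type*} (θ : TimedWord A) : MTL A → ℕ → Prop
  | .tt, _ => True
  | .ff, _ => False
  | .atom a, i => θ.letter i = a
  | .neg φ, i => ¬ MTL.Sat θ φ i
  | .and φ₁ φ₂, i => MTL.Sat θ φ₁ i ∧ MTL.Sat θ φ₂ i
  | .or φ₁ φ₂, i => MTL.Sat θ φ₁ i ∨ MTL.Sat θ φ₂ i
  | .untl φ₁ φ₂ I, i => ∃ j, i ≤ j ∧ MTL.Sat θ φ₂ j ∧ I.Mem (θ.time j - θ.time i) ∧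
      ∀ k, i ≤ k → k < j → MTL.Sat θ φ₁ k
  | .rele φ₁ φ₂ I, i => ¬ ∃ j, i ≤ j ∧ ¬ MTL.Sat θ φ₂ j ∧ I.Mem (θ.time j - θ.time i) ∧
      ∀ k, i ≤ k → k < j → ¬ MTL.Sat θ φ₁ k

/-- `⟦φ⟧`. -/
def MTL.SemLang {A : Type*} (φ : MTL A) : Set (TimedWord A) := {θ | MTL.Sat θ φ 1}

/-- Negative normal form: negation only on letters. -/
def MTL.IsNNF {A : Type*} : MTL A → Prop
  | .neg (.atom _) => True
  | .neg _ => False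
  | .and φ₁ φ₂ => φ₁.IsNNF ∧ φ₂.IsNNF
  | .or φ₁ φ₂ => φ₁.IsNNF ∧ φ₂.IsNNF
  | .untl φ₁ φ₂ _ => φ₁.IsNNF ∧ φ₂.IsNNF
  | .rele φ₁ φ₂ _ => φ₁.IsNNF ∧ φ₂.IsNNF
  | _ => True

mutual
  /-- Negative normal form of a formula. -/
  def MTL.nnf {A : Type*} : MTL A → MTL A
    | .tt => .tt
    | .ff => .ff
    | .atom a => .atom a
    | .neg φ => MTL.nnfNeg φ
    | .and φ₁ φ₂ => .and (MTL.nnf φ₁) (MTL.nnf φ₂)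
    | .or φ₁ φ₂ => .or (MTL.nnf φ₁) (MTL.nnf φ₂)
    | .untl φ₁ φ₂ I => .untl (MTL.nnf φ₁) (MTL.nnf φ₂) I
    | .rele φ₁ φ₂ I => .rele (MTL.nnf φ₁) (MTL.nnf φ₂) I

  /-- Negative normal form of the negation of a formula. -/
  def MTL.nnfNeg {A : Type*} : MTL A → MTL A
    | .tt => .ff
    | .ff => .tt
    | .atom a => .neg (.atom a)
    | .neg φ => MTL.nnf φ
    | .and φ₁ φ₂ => .or (MTL.nnfNeg φ₁) (MTL.nnfNeg φ₂)
    | .or φ₁ φ₂ => .and (MTL.nnfNeg φ₁) (MTL.nnfNeg φ₂)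
    | .untl φ₁ φ₂ I => .rele (MTL.nnfNeg φ₁) (MTL.nnfNeg φ₂) I
    | .rele φ₁ φ₂ I => .untl (MTL.nnfNeg φ₁) (MTL.nnfNeg φ₂) I
end

/-- Outermost connective is `U` or `Ũ`. -/
def MTL.IsTemporal {A : Type*} : MTL A → Prop
  | .untl _ _ _ => True
  | .rele _ _ _ => True
  | _ => False

def MTL.IsRelease {A : Type*} : MTL A → Prop
  | .rele _ _ _ => True
  | _ => False

/-- Subformulas. -/
def MTL.Subf {A : Type*} : MTL A → Set (MTL A)
  | .tt => {MTL.tt}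
  | .ff => {MTL.ff}
  | .atom a => {MTL.atom a}
  | .neg φ => insert (MTL.neg φ) (MTL.Subf φ)
  | .and φ₁ φ₂ => insert (MTL.and φ₁ φ₂) (MTL.Subf φ₁ ∪ MTL.Subf φ₂)
  | .or φ₁ φ₂ => insert (MTL.or φ₁ φ₂) (MTL.Subf φ₁ ∪ MTL.Subf φ₂)
  | .untl φ₁ φ₂ I => insert (MTL.untl φ₁ φ₂ I) (MTL.Subf φ₁ ∪ MTL.Subf φ₂)
  | .rele φ₁ φ₂ I => insert (MTL.rele φ₁ φ₂ I) (MTL.Subf φ₁ ∪ MTL.Subf φ₂)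

/-- MITL wellformedness: every interval is non-singular. -/
def MTL.MITLwf {A : Type*} : MTL A → Prop
  | .neg φ => MTL.MITLwf φ
  | .and φ₁ φ₂ => φ₁.MITLwf ∧ φ₂.MITLwf
  | .or φ₁ φ₂ => φ₁.MITLwf ∧ φ₂.MITLwf
  | .untl φ₁ φ₂ I => I.Nonsingular ∧ φ₁.MITLwf ∧ φ₂.MITLwf
  | .rele φ₁ φ₂ I => I.Nonsingular ∧ φ₁.MITLwf ∧ φ₂.MITLwf
  | _ => True

/-! ### The Ouaknine–Worrell construction `A_φ` -/

/-- `δ(φ,σ)`, with locations named by raw formulas. -/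
def MTL.trans {A : Type*} [DecidableEq A] : MTL A → A → TransFormula (MTL A)
  | .tt, _ => .tt
  | .ff, _ => .ff
  | .atom a, σ => if a = σ then .tt else .ff
  | .neg (.atom a), σ => if a = σ then .ff else .tt
  | .neg _, _ => .ff
  | .and φ₁ φ₂, σ => .and (MTL.trans φ₁ σ) (MTL.trans φ₂ σ)
  | .or φ₁ φ₂, σ => .or (MTL.trans φ₁ σ) (MTL.trans φ₂ σ)
  | .untl φ₁ φ₂ I, σ =>
      .or (.and (.reset (MTL.trans φ₂ σ)) I.memF)
          (.and (.reset (MTL.trans φ₁ σ)) (.and (.loc (.untl φ₁ φ₂ I)) I.leSupF))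
  | .rele φ₁ φ₂ I, σ =>
      .and (.or (.reset (MTL.trans φ₂ σ)) I.notMemF)
           (.or (.reset (MTL.trans φ₁ σ)) (.or (.loc (.rele φ₁ φ₂ I)) I.gtSupF))

/-- Locations of `A_φ`: `φ_init` (i.e. `none`) together with the `U`/`Ũ`-subformulas of `φ`. -/
def MTLLoc {A : Type*} (φ : MTL A) : Type _ :=
  Option {ψ : MTL A // ψ ∈ MTL.Subf φ ∧ MTL.IsTemporal ψ}

open Classical in
noncomputable def embedLoc {A : Type*} (φ : MTL A) (ψ : MTL A) : MTLLoc φ :=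
  if h : ψ ∈ MTL.Subf φ ∧ MTL.IsTemporal ψ then some ⟨ψ, h⟩ else none

/-- The OCATA `A_φ`. -/
noncomputable def mtlOCATA {A : Type*} [DecidableEq A] (φ : MTL A) : OCATA A (MTLLoc φ) where
  init := none
  final := {l | ∃ p, l = some p ∧ MTL.IsRelease p.1}
  δ := fun l σ =>
    match l with
    | none => .reset ((MTL.trans φ σ).map (embedLoc φ))
    | some p => (MTL.trans p.1 σ).map (embedLoc φ)

/-! ### The bound `M(φ)` -/

/-- `(M(φ), M^∞(φ), M^1(φ))`. -/
def MTL.Mtriple {A : Type*} : MTL A → ℕ × ℕ × ℕ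
  | .and φ₁ φ₂ =>
      let t₁ := MTL.Mtriple φ₁; let t₂ := MTL.Mtriple φ₂
      (max 2 (t₁.2.2 + t₂.2.2), t₁.2.1 + t₂.2.1, t₁.2.2 + t₂.2.2)
  | .or φ₁ φ₂ =>
      let t₁ := MTL.Mtriple φ₁; let t₂ := MTL.Mtriple φ₂
      (max 2 (max t₁.2.2 t₂.2.2), max t₁.2.1 t₂.2.1, max t₁.2.2 t₂.2.2)
  | .untl φ₁ φ₂ I =>
      let t₁ := MTL.Mtriple φ₁; let t₂ := MTL.Mtriple φ₂
      (max 2 (t₁.2.1 + t₂.2.2 + 1), (4 * I.ceilInfDiv + 2) + t₁.2.1 + t₂.2.1,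
        t₁.2.1 + t₂.2.2 + 1)
  | .rele φ₁ φ₂ I =>
      let t₁ := MTL.Mtriple φ₁; let t₂ := MTL.Mtriple φ₂
      (max 2 (t₁.2.2 + t₂.2.1 + 1), (2 * I.ceilSupDiv + 2) + t₁.2.1 + t₂.2.1,
        t₁.2.2 + t₂.2.1 + 1)
  | _ => (2, 0, 0)

/-- `M(φ)`. -/
def MTL.M {A : Type*} (φ : MTL A) : ℕ := φ.Mtriple.1

/-! ### The `Merge` operation and the approximation functions `F^k` -/

/-- `I < J` for intervals. -/
def ItvLT (I J : Set ℝ) : Prop := ∀ x ∈ I, ∀ y ∈ J, x < y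

/-- `E'` is obtained from `E` by merging the smallest interval `[0,0]` with
the next interval `I₁` into `[0, sup I₁]`. -/
def MergedOf (E E' : Set (Set ℝ)) : Prop :=
  zeroItv ∈ E ∧ ∃ I₁ ∈ E, I₁ ≠ zeroItv ∧
    (∀ J ∈ E, J ≠ zeroItv → J ≠ I₁ → ItvLT I₁ J) ∧
    E' = insert (Set.Icc 0 (sSup I₁)) (E \ {zeroItv, I₁})

/-- `E' ∈ {Merge(E), E}`. -/
def MergeChoice (E E' : Set (Set ℝ)) : Prop := E' = E ∨ MergedOf E E'

/-- `Merge(C,k)`. -/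
def MergeCk {L : Type*} (C : Set (OState L)) (k : ℕ) : Set (Set (OState L)) :=
  {C' | nbClocksC C' ≤ k ∧ ∀ ℓ, MergeChoice (locSet C ℓ) (locSet C' ℓ)}

/-- Grouping all the intervals of each location into a single interval. -/
def squash {L : Type*} (C : Set (OState L)) : Set (OState L) :=
  {s | (locSet C s.1).Nonempty ∧
    s.2 = Set.Icc (sInf (⋃ I ∈ locSet C s.1, I)) (sSup (⋃ I ∈ locSet C s.1, I))}

open Classical in
/-- The approximation function `F^k`. -/
noncomputable def Fk {L : Type*} (k : ℕ) (C : Set (OState L)) : Set (Set (OState L)) :=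
  if (MergeCk C k).Nonempty then MergeCk C k else {squash C}

/-! ### The Miyano–Hayashi construction -/

/-- Marked configurations. -/
abbrev MState (L : Type*) := Set (L × Set ℝ × Bool)

/-- The underlying configuration. -/
def MState.conf {L : Type*} (s : MState L) : Set (OState L) := (fun x => (x.1, x.2.1)) '' s

/-- All markers are `⊤`. -/
def MState.allTrue {L : Type*} (s : MState L) : Prop := ∀ x ∈ s, x.2.2 = true

def shiftM {L : Type*} (s : MState L) (t : ℝ) : MState L :=
  (fun x => (x.1, shiftItv x.2.1 t, x.2.2)) '' s

/-- Reset all markers to `⊥`. -/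
def resetMarksM {L : Type*} (s : MState L) : MState L := (fun x => (x.1, x.2.1, false)) '' s

/-- A discrete Miyano–Hayashi step (from a non-accepting marked state). -/
def MHStepCore {A L : Type*} (Aut : OCATA A L) (f : Set (OState L) → Set (Set (OState L)))
    (σ : A) (s s' : MState L) : Prop :=
  ∃ m : OState L → Set (OState L),
    (∀ q ∈ MState.conf s, IsMinModel (m q) (Aut.δ q.1 σ) q.2) ∧
    MState.conf s' ∈ f (⋃ q ∈ MState.conf s, m q) ∧
    (∀ ℓ I b₁ b₂, (ℓ, I, b₁) ∈ s' → (ℓ, I, b₂) ∈ s' → b₁ = b₂) ∧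
    (∀ x ∈ s', x.1 ∈ Aut.final → x.2.2 = true) ∧
    (∀ x ∈ s', x.1 ∉ Aut.final →
      (x.2.2 = false ↔ ∃ ℓ I, (ℓ, I, false) ∈ s ∧ ∃ I', (x.1, I') ∈ m (ℓ, I) ∧ I' ⊆ x.2.1))

/-- A discrete step of `MH(A,f)` (markers of an accepting state are first reset to `⊥`). -/
def MHStep {A L : Type*} (Aut : OCATA A L) (f : Set (OState L) → Set (Set (OState L)))
    (σ : A) (s s' : MState L) : Prop :=
  (MState.allTrue s ∧ MHStepCore Aut f σ (resetMarksM s) s') ∨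
  (¬ MState.allTrue s ∧ MHStepCore Aut f σ s s')

structure MHRun {A L : Type*} (Aut : OCATA A L)
    (f : Set (OState L) → Set (Set (OState L))) (θ : TimedWord A) where
  st : ℕ → MState L
  init : st 0 = {(Aut.init, zeroItv, false)}
  step : ∀ i, MHStep Aut f (θ.letter (i + 1)) (shiftM (st i) (θ.time (i + 1) - θ.time i))
    (st (i + 1))

/-- Büchi acceptance on `α` (all markers `⊤`). -/
def MHRun.Accepting {A L : Type*} {Aut : OCATA A L}
    {f : Set (OState L) → Set (Set (OState L))} {θ : TimedWord A}
    (ρ : MHRun Aut f θ) : Prop :=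
  ∀ N, ∃ i, N ≤ i ∧ MState.allTrue (ρ.st i)

/-- `L^ω(MH(A,f))`. -/
def MHLang {A L : Type*} (Aut : OCATA A L)
    (f : Set (OState L) → Set (Set (OState L))) : Set (TimedWord A) :=
  {θ | ∃ ρ : MHRun Aut f θ, ρ.Accepting}

/-! ### Büchi timed automata -/

/-- A Büchi timed automaton with locations `Q` and clocks `X`; a transition
`(b, σ, g, r, b')` has guard `g` (a finite conjunction of clock constraints) and reset `r`. -/
structure TBA (A : Type*) (Q : Type*) (X : Type*) where
  init : Q
  final : Set Q
  trans : Set (Q × A × List (X × Cmp × ℕ) × Set X × Q)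

def GuardSat {X : Type*} (g : List (X × Cmp × ℕ)) (v : X → ℝ) : Prop :=
  ∀ c ∈ g, Cmp.eval c.2.1 (v c.1) c.2.2

open Classical in
noncomputable def resetVal {X : Type*} (r : Set X) (v : X → ℝ) : X → ℝ :=
  fun x => if x ∈ r then 0 else v x

structure TBARun {A Q X : Type*} (B : TBA A Q X) (θ : TimedWord A) where
  loc : ℕ → Q
  val : ℕ → X → ℝ
  init_loc : loc 0 = B.init
  init_val : val 0 = fun _ => 0
  step : ∀ i, ∃ g r, (loc i, θ.letter (i + 1), g, r, loc (i + 1)) ∈ B.trans ∧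
    GuardSat g (fun x => val i x + (θ.time (i + 1) - θ.time i)) ∧
    val (i + 1) = resetVal r (fun x => val i x + (θ.time (i + 1) - θ.time i))

def TBARun.Accepting {A Q X : Type*} {B : TBA A Q X} {θ : TimedWord A}
    (ρ : TBARun B θ) : Prop :=
  ∀ N, ∃ i, N ≤ i ∧ ρ.loc i ∈ B.final

/-- `L^ω(B)`. -/
def TBALang {A Q X : Type*} (B : TBA A Q X) : Set (TimedWord A) :=
  {θ | ∃ ρ : TBARun B θ, ρ.Accepting}


theorem Cmp.eval_negate_iff (op : Cmp) (v : ℝ) (c : ℕ) :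
    op.negate.eval v c ↔ ¬ op.eval v c := by
  cases op <;> simp [Cmp.eval, Cmp.negate]

/-- A model of a formula and a model of its dual share a state. -/
theorem Models.inter_dual_nonempty {L : Type*} {M M' : Set (OState L)} {γ : TransFormula L}
    {I : Set ℝ} (hI : I.Nonempty) (h : Models M γ I) (h' : Models M' γ.dual I) :
    (M ∩ M').Nonempty := by
  induction γ generalizing I with
  | tt => exact h'.elim
  | ff => exact h.elim
  | or γ₁ γ₂ ih₁ ih₂ => exact h.elim (ih₁ hI · h'.1) (ih₂ hI · h'.2)
  | and γ₁ γ₂ ih₁ ih₂ => exact h'.elim (ih₁ hI h.1) (ih₂ hI h.2)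
  | loc ℓ => exact ⟨(ℓ, I), h, h'⟩
  | cmp op c =>
    obtain ⟨v, hv⟩ := hI
    exact ((Cmp.eval_negate_iff op v c).1 (h' v hv) (h v hv)).elim
  | reset γ ih => exact ih (singleton_nonempty 0) h h'

theorem FRun.edge_of_mem_model {A L : Type*} {Aut : OCATA A L} {θ : TimedWord A}
    (ρ : FRun Aut IdApprox θ) {i : ℕ} {s s' : OState L} (hs : s ∈ ρ.config i)
    (hs' : s' ∈ ρ.model i (s.1, shiftItv s.2 (θ.time (i + 1) - θ.time i))) :
    ρ.Edge i s s' := by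
  have hsucc := Set.mem_singleton_iff.1 (ρ.succ i)
  refine ⟨hs, ?_, s'.2, hs', Subset.rfl⟩
  rw [hsucc]
  exact mem_biUnion (mem_image_of_mem _ hs) hs'

/-- A state common to a run and a run of the dual automaton has a common successor. -/
theorem FRun.exists_common_edge {A L : Type*} {Aut : OCATA A L} {θ : TimedWord A}
    (ρ : FRun Aut IdApprox θ) (ρ' : FRun Aut.dual IdApprox θ) {i : ℕ} {s : OState L}
    (hs : s ∈ ρ.config i) (hs' : s ∈ ρ'.config i) :
    ∃ s', ρ.Edge i s s' ∧ ρ'.Edge i s s' := by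
  have hne : (shiftItv s.2 (θ.time (i + 1) - θ.time i)).Nonempty :=
    (((ρ.isConfig i).2.1 s hs).1).image _
  obtain ⟨s', h, h'⟩ := Models.inter_dual_nonempty hne
    (ρ.minModel i _ (mem_image_of_mem _ hs)).1 (ρ'.minModel i _ (mem_image_of_mem _ hs')).1
  exact ⟨s', ρ.edge_of_mem_model hs h, ρ'.edge_of_mem_model hs' h'⟩

/-- An `Id`-run of a tree-like OCATA `A` and an `Id`-run of its dual `A^C`
on the same infinite timed word have a common branch. -/
theorem tocata_common_branch {A L : Type*} [Finite A] [Finite L] (Aut : OCATA A L)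
    (hT : IsTOCATA Aut) (θ : TimedWord A)
    (ρ : FRun Aut IdApprox θ) (ρ' : FRun Aut.dual IdApprox θ) :
    ∃ e : ℕ → OState L, ∀ i : ℕ,
      e i ∈ ρ.config i ∧ e i ∈ ρ'.config i ∧
      ρ.Edge i (e i) (e (i + 1)) ∧ ρ'.Edge i (e i) (e (i + 1)) := by
  have hstep : ∀ i (s : {s : OState L // s ∈ ρ.config i ∧ s ∈ ρ'.config i}),
      ∃ s' : {s' : OState L // s' ∈ ρ.config (i + 1) ∧ s' ∈ ρ'.config (i + 1)},
        ρ.Edge i s s' ∧ ρ'.Edge i s s' := fun i s =>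
    let ⟨s', h, h'⟩ := ρ.exists_common_edge ρ' s.2.1 s.2.2
    ⟨⟨s', h.2.1, h'.2.1⟩, h, h'⟩
  choose next hnext using hstep
  let e : ∀ i, {s : OState L // s ∈ ρ.config i ∧ s ∈ ρ'.config i} := fun i =>
    Nat.rec ⟨(Aut.init, zeroItv), by simp [ρ.init], by simp [ρ'.init, OCATA.dual]⟩ next i
  exact ⟨fun i => (e i).1, fun i => ⟨(e i).2.1, (e i).2.2, hnext i (e i)⟩⟩

end OcataPaper
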